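/- Let Q be a square matrix over ℝ (indexed by a finite type) such that I − Q is invertible, let α be a real number with α ≠ 1, and set Q̃ = (1−α) • Q + α • I. Let Γ denote the all-ones column vector, M = (I − Q)⁻¹ · Γ and M̃ = (I − Q̃)⁻¹ · Γ. Then M̃ = (1−α)⁻¹ • M; i.e., every entry of M̃ equals the corresponding entry of M divided by (1−α). -/

import Mathlib

open Matrix

/-- With Q̃ = (1-α)•Q + α•I and Γ the all-ones vector, the vector of expected
absorption times M̃ = (I - Q̃)⁻¹Γ equals (1-α)⁻¹ • M where M = (I - Q)⁻¹Γ. -/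
theorem stmt_7 {n : Type*} [Fintype n] [DecidableEq n]
    (Q : Matrix n n ℝ) (hQ : IsUnit (1 - Q)) (α : ℝ) (hα : α ≠ 1) :
    (1 - ((1 - α) • Q + α • (1 : Matrix n n ℝ)))⁻¹ *ᵥ (fun _ => (1 : ℝ))
      = (1 - α)⁻¹ • ((1 - Q)⁻¹ *ᵥ (fun _ => (1 : ℝ))) := by
  have h : 1 - ((1 - α) • Q + α • (1 : Matrix n n ℝ)) = (1 - α) • (1 - Q) := by
    module
  have hα' : 1 - α ≠ 0 := sub_ne_zero.mpr hα.symm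
  have hinv : ((1 - α) • (1 - Q))⁻¹ = (1 - α)⁻¹ • (1 - Q)⁻¹ := by
    refine Matrix.inv_eq_left_inv ?_
    rw [smul_mul_smul_comm, inv_mul_cancel₀ hα', one_smul,
      Matrix.nonsing_inv_mul _ ((Matrix.isUnit_iff_isUnit_det _).mp hQ)]
  rw [h, hinv, Matrix.smul_mulVec]
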